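/- Let n ≥ 1 and let F : ℝ^{2n} × ℝ → ℝ^{2n} × ℝ be a bijection which is a group homomorphism of the Heisenberg group H(n) and satisfies F ∘ δ_ε = δ_ε ∘ F for every ε > 0. Then there exist an invertible real 2n×2n matrix A and a real number a ≠ 0 with ω(Ax, Ay) = a·ω(x, y) for all x, y ∈ ℝ^{2n}, such that F(x, x̄) = (Ax, a·x̄) for all (x, x̄) ∈ ℝ^{2n} × ℝ; moreover det A = aⁿ. Conversely, every map of this form is a bijective group homomorphism of H(n) commuting with all dilations. -/

import Mathlib

open MeasureTheory Set Function
open scoped BigOperators Topology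

noncomputable section

/-- The horizontal layer of the Heisenberg group `H(n)`: `ℝ^{2n}` presented as
functions on `Fin n ⊕ Fin n`. -/
abbrev P (n : ℕ) := (Fin n ⊕ Fin n) → ℝ

/-- The standard symplectic form `ω(x,y) = ⟨Jx, y⟩` on `ℝ^{2n}`. -/
def symp {n : ℕ} (x y : P n) : ℝ :=
  ∑ i : Fin n, (x (Sum.inl i) * y (Sum.inr i) - x (Sum.inr i) * y (Sum.inl i))

/-- The Heisenberg group `H(n) = ℝ^{2n} × ℝ` as a set. -/
abbrev Heis (n : ℕ) := P n × ℝ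

/-- The Heisenberg group operation. -/
def hmul {n : ℕ} (p q : Heis n) : Heis n :=
  (p.1 + q.1, p.2 + q.2 + (1/2) * symp p.1 q.1)

/-- The dilation `δ_ε(x, x̄) = (εx, ε²x̄)`. -/
def dil {n : ℕ} (ε : ℝ) (p : Heis n) : Heis n := (ε • p.1, ε^2 * p.2)

open Matrix in
lemma symp_eq_dotProduct {n : ℕ} (x y : P n) :
    symp x y = x ⬝ᵥ (-Matrix.J (Fin n) ℝ) *ᵥ y := by
  simp [symp, Matrix.J, Matrix.fromBlocks_neg, Matrix.fromBlocks_mulVec, dotProduct,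
    Fintype.sum_sum_type, Finset.sum_add_distrib, Matrix.neg_mulVec,
    sub_eq_add_neg]

lemma symp_self {n : ℕ} (x : P n) : symp x x = 0 :=
  Finset.sum_eq_zero fun _ _ => by ring

lemma symp_swap {n : ℕ} (x y : P n) : symp y x = -symp x y := by
  simp only [symp, ← Finset.sum_neg_distrib]
  exact Finset.sum_congr rfl fun _ _ => by ring

@[simp] lemma symp_zero_left {n : ℕ} (x : P n) : symp 0 x = 0 := by simp [symp]

@[simp] lemma symp_zero_right {n : ℕ} (x : P n) : symp x 0 = 0 := by simp [symp]

lemma exists_symp_eq {n : ℕ} (hn : 1 ≤ n) (t : ℝ) : ∃ x y : P n, symp x y = t := by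
  refine ⟨Pi.single (Sum.inl ⟨0, hn⟩) t, Pi.single (Sum.inr ⟨0, hn⟩) 1, ?_⟩
  simp [symp, Pi.single_apply]

open Matrix in
/-- A matrix scaling the standard symplectic form by `a ≠ 0` has determinant `a ^ n`. -/
lemma det_eq_pow_of_symp_mulVec {n : ℕ} (A : Matrix (Fin n ⊕ Fin n) (Fin n ⊕ Fin n) ℝ) {a : ℝ}
    (ha : a ≠ 0) (hA : ∀ x y : P n, symp (A *ᵥ x) (A *ᵥ y) = a * symp x y) :
    A.det = a ^ n := by
  have hJ : Aᵀ * J (Fin n) ℝ * A = a • J (Fin n) ℝ := by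
    refine Matrix.ext_of_mulVec_single fun j => funext fun i => ?_
    have h := hA (Pi.single i 1) (Pi.single j 1)
    simp only [symp_eq_dotProduct, Matrix.neg_mulVec, dotProduct_neg, mul_neg, Matrix.mulVec_mulVec,
      Matrix.neg_mul] at h
    rw [dotProduct_comm (A *ᵥ _), Matrix.dotProduct_mulVec, ← Matrix.mulVec_transpose,
      Matrix.mulVec_mulVec, dotProduct_comm, single_one_dotProduct, single_one_dotProduct,
      neg_inj] at h
    rw [Matrix.mul_assoc, h, Matrix.smul_mulVec, Pi.smul_apply, smul_eq_mul]
  set D : Matrix (Fin n ⊕ Fin n) (Fin n ⊕ Fin n) ℝ := fromBlocks 1 0 0 (a⁻¹ • 1) with hD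
  have hDdet : D.det = (a⁻¹) ^ n := by
    simp [hD, Matrix.det_fromBlocks_zero₂₁]
  have hDJ : Dᵀ * (a • J (Fin n) ℝ) * D = J (Fin n) ℝ := by
    simp [hD, J, Matrix.fromBlocks_transpose, Matrix.fromBlocks_multiply,
      Matrix.fromBlocks_smul, smul_smul, ha]
  have hmem : A * D ∈ symplecticGroup (Fin n) ℝ := by
    rw [SymplecticGroup.mem_iff', Matrix.transpose_mul]
    calc Dᵀ * Aᵀ * J (Fin n) ℝ * (A * D) = Dᵀ * (Aᵀ * J (Fin n) ℝ * A) * D := by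
          simp only [Matrix.mul_assoc]
      _ = J (Fin n) ℝ := by rw [hJ, hDJ]
  have h := SymplecticGroup.det_eq_one hmem
  rw [Matrix.det_mul, hDdet, inv_pow] at h
  exact (mul_inv_eq_one₀ (pow_ne_zero n ha)).mp h

/-- An additive map on a real vector space that commutes with positive scalars is linear. -/
def AddMonoidHom.toLinearMapOfPosHomogeneous {E E' : Type*} [AddCommGroup E] [Module ℝ E]
    [AddCommGroup E'] [Module ℝ E'] (f : E →+ E')
    (hf : ∀ c : ℝ, 0 < c → ∀ x, f (c • x) = c • f x) : E →ₗ[ℝ] E' where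
  toFun := f
  map_add' := f.map_add
  map_smul' c x := by
    rcases lt_trichotomy c 0 with hc | rfl | hc
    · have h := hf (-c) (neg_pos.mpr hc) x
      simpa only [neg_smul, map_neg, neg_inj, RingHom.id_apply] using h
    · simp
    · exact hf c hc x

section DilationHom

variable {n : ℕ} {F : Heis n → Heis n}

/-- A homomorphism of the Heisenberg group maps vertical elements, being commutators, to
vertical elements. -/
lemma fst_map_vertical (hn : 1 ≤ n) (hF : ∀ p q : Heis n, F (hmul p q) = hmul (F p) (F q))
    (t : ℝ) : (F (0, t)).1 = 0 := by
  obtain ⟨x, y, hxy⟩ := exists_symp_eq hn t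
  have h : hmul (0, t) (hmul (y, 0) (x, 0)) = hmul (x, 0) (y, 0) := by
    simp only [hmul, symp_zero_left, symp_swap x y, hxy]
    ext
    · simp [add_comm]
    · dsimp only
      ring
  have h' := congrArg F h
  simp only [hF] at h'
  replace h' := congrArg Prod.fst h'
  simp only [hmul] at h'
  rw [add_comm (F (y, 0)).1] at h'
  exact add_eq_right.mp h'

lemma fst_map_eq (hn : 1 ≤ n) (hF : ∀ p q : Heis n, F (hmul p q) = hmul (F p) (F q))
    (x : P n) (t : ℝ) : (F (x, t)).1 = (F (x, 0)).1 := by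
  have h : ((x, t) : Heis n) = hmul (x, 0) (0, t) := by simp [hmul]
  rw [h, hF]
  simp [hmul, fst_map_vertical hn hF]

/-- Horizontal elements are mapped to horizontal elements, since the vertical component is both
additive along lines and quadratic. -/
lemma snd_map_horizontal (hF : ∀ p q : Heis n, F (hmul p q) = hmul (F p) (F q))
    (hδ : ∀ ε : ℝ, 0 < ε → F ∘ dil ε = dil ε ∘ F) (x : P n) : (F (x, 0)).2 = 0 := by
  have h₁ : hmul (x, 0) (x, 0) = dil 2 ((x, 0) : Heis n) := by
    simp [hmul, dil, symp_self, two_smul]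
  have h₂ := congrArg Prod.snd (congrFun (hδ 2 two_pos) (x, 0))
  simp only [Function.comp_apply, ← h₁, hF] at h₂
  simp only [hmul, dil, symp_self] at h₂
  linarith

/-- A homomorphism of the Heisenberg group commuting with dilations acts linearly on each layer. -/
lemma exists_matrix_of_dilation_hom (hn : 1 ≤ n)
    (hF : ∀ p q : Heis n, F (hmul p q) = hmul (F p) (F q))
    (hδ : ∀ ε : ℝ, 0 < ε → F ∘ dil ε = dil ε ∘ F) :
    ∃ (A : Matrix (Fin n ⊕ Fin n) (Fin n ⊕ Fin n) ℝ) (a : ℝ),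
      ∀ p : Heis n, F p = (A.mulVec p.1, a * p.2) := by
  let f : P n →+ P n := AddMonoidHom.mk' (fun x => (F (x, 0)).1) fun x y => by
    have h := congrArg Prod.fst (hF (x, 0) (y, 0))
    simp only [hmul] at h
    rw [fst_map_eq hn hF] at h
    exact h
  let L : P n →ₗ[ℝ] P n := f.toLinearMapOfPosHomogeneous fun c hc x => by
    simpa [dil, f] using congrArg Prod.fst (congrFun (hδ c hc) (x, 0))
  let g : ℝ →+ ℝ := AddMonoidHom.mk' (fun t => (F (0, t)).2) fun s t => by
    simpa [hmul, fst_map_vertical hn hF] using congrArg Prod.snd (hF (0, s) (0, t))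
  let G : ℝ →ₗ[ℝ] ℝ := g.toLinearMapOfPosHomogeneous fun c hc t => by
    simpa [dil, g, Real.sq_sqrt hc.le] using
      congrArg Prod.snd (congrFun (hδ (√c) (Real.sqrt_pos.mpr hc)) (0, t))
  refine ⟨LinearMap.toMatrix' L, G 1, fun ⟨x, t⟩ => Prod.ext ?_ ?_⟩
  · rw [LinearMap.toMatrix'_mulVec]
    exact fst_map_eq hn hF x t
  · have h : ((x, t) : Heis n) = hmul (x, 0) (0, t) := by simp [hmul]
    have hG : G t = G 1 * t := by
      rw [mul_comm, ← smul_eq_mul t, ← map_smul, smul_eq_mul, mul_one]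
    rw [h, hF]
    simp only [hmul, fst_map_vertical hn hF, snd_map_horizontal hF hδ, symp_zero_right, mul_zero,
      add_zero, zero_add]
    exact hG

end DilationHom

/-- Structure theorem for bijective dilation-commuting group endomorphisms of the
Heisenberg group `H(n)`: they are exactly the maps `(x, x̄) ↦ (Ax, a·x̄)` with `A`
an invertible `2n×2n` matrix and `a ≠ 0` satisfying `ω(Ax, Ay) = a·ω(x, y)`;
moreover `det A = aⁿ`. -/
theorem structure_of_linear_transformations_of_Heisenberg
    (n : ℕ) (hn : 1 ≤ n) :
    (∀ F : Heis n → Heis n,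
      Function.Bijective F →
      (∀ p q : Heis n, F (hmul p q) = hmul (F p) (F q)) →
      (∀ ε : ℝ, 0 < ε → F ∘ dil ε = dil ε ∘ F) →
      ∃ (A : Matrix (Fin n ⊕ Fin n) (Fin n ⊕ Fin n) ℝ) (a : ℝ),
        A.det ≠ 0 ∧ a ≠ 0 ∧
        (∀ x y : P n, symp (A.mulVec x) (A.mulVec y) = a * symp x y) ∧
        (∀ p : Heis n, F p = (A.mulVec p.1, a * p.2)) ∧
        A.det = a ^ n)
    ∧
    (∀ (A : Matrix (Fin n ⊕ Fin n) (Fin n ⊕ Fin n) ℝ) (a : ℝ),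
      A.det ≠ 0 → a ≠ 0 →
      (∀ x y : P n, symp (A.mulVec x) (A.mulVec y) = a * symp x y) →
      Function.Bijective (fun p : Heis n => ((A.mulVec p.1, a * p.2) : Heis n)) ∧
      (∀ p q : Heis n,
        ((A.mulVec (hmul p q).1, a * (hmul p q).2) : Heis n)
          = hmul (A.mulVec p.1, a * p.2) (A.mulVec q.1, a * q.2)) ∧
      (∀ ε : ℝ, 0 < ε →
        (fun p : Heis n => ((A.mulVec p.1, a * p.2) : Heis n)) ∘ dil ε
          = dil ε ∘ (fun p : Heis n => ((A.mulVec p.1, a * p.2) : Heis n)))) := by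
  refine ⟨fun F hbij hF hδ => ?_, fun A a hdet ha hA => ⟨⟨?_, ?_⟩, ?_, ?_⟩⟩
  · obtain ⟨A, a, hFA⟩ := exists_matrix_of_dilation_hom hn hF hδ
    have ha : a ≠ 0 := by
      rintro rfl
      have h : ((0, 1) : Heis n) = (0, 0) := hbij.injective (by simp [hFA])
      exact one_ne_zero (congrArg Prod.snd h)
    have hA : ∀ x y : P n, symp (A.mulVec x) (A.mulVec y) = a * symp x y := fun x y => by
      have h := congrArg Prod.snd (hF (x, 0) (y, 0))
      simp only [hFA, hmul] at h
      linarith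
    have hdet := det_eq_pow_of_symp_mulVec A ha hA
    exact ⟨A, a, hdet ▸ pow_ne_zero n ha, ha, hA, hFA, hdet⟩
  · rintro ⟨x, s⟩ ⟨y, t⟩ h
    obtain ⟨h₁, h₂⟩ := Prod.mk.inj h
    exact Prod.ext (Matrix.mulVec_injective_of_isUnit
      ((Matrix.isUnit_iff_isUnit_det A).mpr hdet.isUnit) h₁) (mul_left_cancel₀ ha h₂)
  · rintro ⟨y, t⟩
    refine ⟨(A⁻¹.mulVec y, a⁻¹ * t), Prod.ext ?_ (mul_inv_cancel_left₀ ha t)⟩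
    simp [Matrix.mulVec_mulVec, Matrix.mul_nonsing_inv A hdet.isUnit]
  · intro p q
    simp only [hmul, hA, Matrix.mulVec_add]
    ext1
    · rfl
    · dsimp only
      ring
  · intro ε _
    funext p
    simp only [Function.comp_apply, dil, Matrix.mulVec_smul]
    ext1
    · rfl
    · dsimp only
      ring
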